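/- Let M = ⟨W, v⁺, v⁻⟩ be a BD model and define the BD model M* = ⟨W, (v*)⁺, (v*)⁻⟩ by (v*)⁺(p) = W∖v⁻(p) and (v*)⁻(p) = W∖v⁺(p) for every propositional variable p. Then for every L_BD formula φ: |φ|⁺_M = W∖|φ|⁻_{M*} and |φ|⁻_M = W∖|φ|⁺_{M*}. -/

import Mathlib

inductive BD : Type where
  | var : ℕ → BD
  | neg : BD → BD
  | and : BD → BD → BD
  | or  : BD → BD → BD

structure BDModel (W : Type) where
  vpos : ℕ → Set W
  vneg : ℕ → Set W

mutual
  def suppT {W : Type} (M : BDModel W) : BD → W → Prop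
    | .var p, w => w ∈ M.vpos p
    | .neg φ, w => suppF M φ w
    | .and φ χ, w => suppT M φ w ∧ suppT M χ w
    | .or φ χ, w => suppT M φ w ∨ suppT M χ w
  def suppF {W : Type} (M : BDModel W) : BD → W → Prop
    | .var p, w => w ∈ M.vneg p
    | .neg φ, w => suppT M φ w
    | .and φ χ, w => suppF M φ w ∨ suppF M χ w
    | .or φ χ, w => suppF M φ w ∧ suppF M χ w
end

def extP {W : Type} (M : BDModel W) (φ : BD) : Set W := {w | suppT M φ w}
def extN {W : Type} (M : BDModel W) (φ : BD) : Set W := {w | suppF M φ w}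

/-- The "conflation" model `M*`. -/
def starModel {W : Type} (M : BDModel W) : BDModel W where
  vpos := fun p => (M.vneg p)ᶜ
  vneg := fun p => (M.vpos p)ᶜ

theorem suppT_suppF_iff_not_starModel {W : Type} (M : BDModel W) (φ : BD) (w : W) :
    (suppT M φ w ↔ ¬ suppF (starModel M) φ w) ∧ (suppF M φ w ↔ ¬ suppT (starModel M) φ w) := by
  induction φ with
  | var p => simp [suppT, suppF, starModel]
  | neg φ ih => simpa only [suppT, suppF] using ih.symm
  | and φ χ ihφ ihχ => simp only [suppT, suppF, ihφ, ihχ]; tauto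
  | or φ χ ihφ ihχ => simp only [suppT, suppF, ihφ, ihχ]; tauto

theorem star_extensions {W : Type} [Nonempty W] (M : BDModel W) (φ : BD) :
    extP M φ = (extN (starModel M) φ)ᶜ ∧ extN M φ = (extP (starModel M) φ)ᶜ := by
  exact ⟨Set.ext fun w => (suppT_suppF_iff_not_starModel M φ w).1,
    Set.ext fun w => (suppT_suppF_iff_not_starModel M φ w).2⟩
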